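/- arXiv:1105.4036 — 2 statements merged into one kernel-verified Lean document; each statement's English description precedes it below -/
import Mathlib

section
/- Let Γ be a finite separable graph with a single dissipative vertex p. For any non-dissipative vertex v, let CP_v = C_1...C_r be the unique minimal block-path of blocks joining v to p. Then the avalanche triggered by adding one chip at v to a recurrent configuration c depends only on the restrictions of c to the blocks C_1,...,C_r; i.e., if two recurrent configurations agree on all blocks of CP_v, the avalanches they trigger (the multiset of fired vertices with multiplicities) coincide. -/
variable {V : Type*}

/-- Dhar's burning criterion for recurrence. -/
def SandpileRecurrent (G : SimpleGraph V) (p : V) (c : V → ℕ) : Prop :=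
  ∃ ord : V → ℕ, Function.Injective ord ∧ ord p = 0 ∧
    ∀ v, v ≠ p →
      {w | G.Adj w v}.ncard ≤ c v + {w | G.Adj w v ∧ ord w < ord v}.ncard

/-- Stability of a configuration. -/
def SandpileStable (G : SimpleGraph V) (p : V) (c : V → ℕ) : Prop :=
  ∀ v, v ≠ p → c v < {w | G.Adj w v}.ncard

/-- Chips at `v` after firing each vertex `w` of `G` `u w` times, starting
from the configuration `c`. -/
def SandpileToppleVal [Fintype V] (G : SimpleGraph V) [DecidableRel G.Adj]
    (c u : V → ℕ) (v : V) : ℤ :=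
  (c v : ℤ) + (∑ w : V, if G.Adj w v then (u w : ℤ) else 0) -
    (G.degree v : ℤ) * (u v : ℤ)

/-- `u` records, for each vertex, the number of times it is fired in the
avalanche stabilizing `c` (the odometer), characterized by the least action
principle: the result is stable and `u` is pointwise minimal among
nonnegative-and-stable firing vectors not firing `p`. -/
def SandpileIsOdometer [Fintype V] (G : SimpleGraph V) [DecidableRel G.Adj]
    (p : V) (c u : V → ℕ) : Prop :=
  u p = 0 ∧
  (∀ v, v ≠ p → 0 ≤ SandpileToppleVal G c u v ∧
    SandpileToppleVal G c u v < G.degree v) ∧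
  (∀ u' : V → ℕ, u' p = 0 →
    (∀ v, v ≠ p → 0 ≤ SandpileToppleVal G c u' v ∧
      SandpileToppleVal G c u' v < G.degree v) →
    ∀ v, u v ≤ u' v)

/-- `B` induces a 2-connected subgraph of `G`. -/
def TwoConnectedOn [DecidableEq V] (G : SimpleGraph V) (B : Finset V) : Prop :=
  2 < B.card ∧ (G.induce (B : Set V)).Connected ∧
    ∀ x ∈ B, (G.induce ((B.erase x : Finset V) : Set V)).Connected

/-- `B` spans a single edge or a 2-connected induced subgraph of `G`. -/
def BlockProp [DecidableEq V] (G : SimpleGraph V) (B : Finset V) : Prop :=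
  (∃ x y, G.Adj x y ∧ B = {x, y}) ∨ TwoConnectedOn G B

/-- `B` is a block of `G`. -/
def IsBlock [DecidableEq V] (G : SimpleGraph V) (B : Finset V) : Prop :=
  BlockProp G B ∧ ∀ B', B ⊆ B' → BlockProp G B' → B' = B

/-- A connected graph is separable if removing some single vertex
disconnects it. -/
def Separable (G : SimpleGraph V) : Prop :=
  ∃ x : V, ¬ (G.induce {y | y ≠ x}).Connected

namespace SandAux

theorem patch {V : Type*} (G : SimpleGraph V) (T0 T : Set V) (hT : T0 ⊆ T)
    (h0 : (G.induce T0).Connected)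
    (h : ∀ t ∈ T, ∃ s : Set V, s ⊆ T ∧ t ∈ s ∧ (s ∩ T0).Nonempty ∧ (G.induce s).Connected) :
    (G.induce T).Connected := by
  obtain ⟨⟨u, hu⟩⟩ := h0.nonempty
  refine SimpleGraph.induce_connected_of_patches u (hT hu) ?_
  intro t ht
  obtain ⟨s, hs, hts, hne, hc⟩ := h t ht
  refine ⟨s ∪ T0, Set.union_subset hs hT, Or.inr hu, Or.inl hts, ?_⟩
  exact (SimpleGraph.induce_union_connected hc.preconnected h0.preconnected hne).preconnected _ _

theorem path_avoid {V : Type*} [DecidableEq V] (G : SimpleGraph V) {x y : V} (Q : G.Walk x y)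
    (hQ : Q.IsPath) (u d : V) (hu : u ∈ Q.support) (hud : u ≠ d) :
    ∃ s : Set V, (∀ a ∈ s, a ∈ Q.support) ∧ u ∈ s ∧ d ∉ s ∧ (x ∈ s ∨ y ∈ s) ∧
      (G.induce s).Connected := by
  by_cases hd : d ∈ Q.support
  · have hspec := Q.take_spec hd
    have hu' : u ∈ ((Q.takeUntil d hd).append (Q.dropUntil d hd)).support := by
      rw [hspec]; exact hu
    rw [SimpleGraph.Walk.mem_support_append_iff] at hu'
    rcases hu' with h | h
    · refine ⟨{a | a ∈ ((Q.takeUntil d hd).takeUntil u h).support}, ?_, ?_, ?_, ?_, ?_⟩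
      · intro a ha
        exact Q.support_takeUntil_subset_support hd
          ((Q.takeUntil d hd).support_takeUntil_subset_support h ha)
      · exact SimpleGraph.Walk.end_mem_support _
      · exact SimpleGraph.Walk.endpoint_notMem_support_takeUntil (hQ.takeUntil hd) h hud.symm
      · exact Or.inl (SimpleGraph.Walk.start_mem_support _)
      · exact SimpleGraph.Walk.connected_induce_support _
    · have h2 : u ∈ (Q.dropUntil d hd).reverse.support := by
        rw [SimpleGraph.Walk.support_reverse]; simpa using h
      refine ⟨{a | a ∈ ((Q.dropUntil d hd).reverse.takeUntil u h2).support}, ?_, ?_, ?_, ?_, ?_⟩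
      · intro a ha
        have := ((Q.dropUntil d hd).reverse).support_takeUntil_subset_support h2 ha
        rw [SimpleGraph.Walk.support_reverse] at this
        exact Q.support_dropUntil_subset_support hd (by simpa using this)
      · exact SimpleGraph.Walk.end_mem_support _
      · exact SimpleGraph.Walk.endpoint_notMem_support_takeUntil (hQ.dropUntil hd).reverse h2
          hud.symm
      · exact Or.inr (SimpleGraph.Walk.start_mem_support _)
      · exact SimpleGraph.Walk.connected_induce_support _
  · exact ⟨{a | a ∈ Q.support}, fun a ha => ha, hu, hd,
      Or.inl (SimpleGraph.Walk.start_mem_support _), SimpleGraph.Walk.connected_induce_support _⟩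

theorem singleton_conn {V : Type*} (G : SimpleGraph V) (s : Set V) (x : V) (h : s = {x}) :
    (G.induce s).Connected := by
  subst h
  have : Subsingleton ({x} : Set V) := inferInstance
  exact ⟨fun a b => by rw [Subsingleton.elim a b]⟩

theorem block_facts {V : Type*} [DecidableEq V] (G : SimpleGraph V) (B : Finset V)
    (h : BlockProp G B) : 2 ≤ B.card ∧ (G.induce (B : Set V)).Connected ∧
      ∀ d, (G.induce ((B.erase d : Finset V) : Set V)).Connected := by
  have key : 2 ≤ B.card ∧ (G.induce (B : Set V)).Connected ∧
      ∀ d ∈ B, (G.induce ((B.erase d : Finset V) : Set V)).Connected := by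
    rcases h with ⟨x, y, hxy, rfl⟩ | ⟨h1, h2, h3⟩
    · refine ⟨by rw [Finset.card_pair hxy.ne], ?_, ?_⟩
      · have := SimpleGraph.induce_pair_connected_of_adj hxy
        rw [Finset.coe_pair]; exact this
      · intro d hd
        have hne := hxy.ne
        rcases Finset.mem_insert.1 hd with rfl | hd
        · apply singleton_conn G _ y
          ext z; simp; grind
        · rw [Finset.mem_singleton] at hd
          subst hd
          apply singleton_conn G _ x
          ext z; simp; grind
    · exact ⟨h1.le, h2, h3⟩
  refine ⟨key.1, key.2.1, fun d => ?_⟩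
  by_cases hd : d ∈ B
  · exact key.2.2 d hd
  · rw [Finset.erase_eq_of_notMem hd]; exact key.2.1

/-- `x` is reached from `w` without touching `B` elsewhere. -/
def Gate {V : Type*} (G : SimpleGraph V) (B : Set V) (w x : V) : Prop :=
  x ∈ B ∧ ∃ q : G.Walk w x, ∀ a ∈ q.support, a ∈ B → a = x

theorem gate_unique {V : Type*} [DecidableEq V] (G : SimpleGraph V) (B : Finset V)
    (hB : IsBlock G B) (w x y : V) (hx : Gate G (B : Set V) w x) (hy : Gate G (B : Set V) w y) :
    x = y := by
  obtain ⟨hxB, q1, h1⟩ := hx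
  obtain ⟨hyB, q2, h2⟩ := hy
  by_contra hne
  obtain ⟨Q, hQdef⟩ : ∃ Q, Q = (q1.reverse.append q2).bypass := ⟨_, rfl⟩
  have hQ : Q.IsPath := by rw [hQdef]; exact SimpleGraph.Walk.bypass_isPath _
  have hsupp : ∀ a ∈ Q.support, a ∈ B → a = x ∨ a = y := by
    intro a ha haB
    rw [hQdef] at ha
    have := SimpleGraph.Walk.support_bypass_subset_support _ ha
    rw [SimpleGraph.Walk.mem_support_append_iff, SimpleGraph.Walk.support_reverse,
      List.mem_reverse] at this
    rcases this with h | h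
    · exact Or.inl (h1 a h haB)
    · exact Or.inr (h2 a h haB)
  have hedge : s(x, y) ∉ Q.edges := by
    intro he
    rw [hQdef] at he
    have := SimpleGraph.Walk.edges_bypass_subset_edges _ he
    rw [SimpleGraph.Walk.edges_append, SimpleGraph.Walk.edges_reverse, List.mem_append,
      List.mem_reverse] at this
    rcases this with h | h
    · exact hne (h1 y (q1.snd_mem_support_of_mem_edges h) hyB).symm
    · exact hne (h2 x (q2.fst_mem_support_of_mem_edges h) hxB)
  have hint : ∃ b ∈ Q.support, b ∉ B := by
    clear hQdef
    cases Q with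
    | nil => exact absurd rfl hne
    | @cons _ b _ hadj q =>
      refine ⟨b, by simp, fun hb => ?_⟩
      rcases hsupp b (by simp) hb with rfl | rfl
      · exact hadj.ne rfl
      · exact hedge (by simp)
  obtain ⟨b, hbQ, hbB⟩ := hint
  obtain ⟨hcard, hconn, herase⟩ := block_facts G B hB.1
  have hsub : B ⊆ B ∪ Q.support.toFinset := Finset.subset_union_left
  have hbU : b ∈ B ∪ Q.support.toFinset := by simp [hbQ]
  have hEq := hB.2 (B ∪ Q.support.toFinset) hsub (Or.inr ⟨?_, ?_, ?_⟩)
  · exact hbB (hEq ▸ hbU)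
  · have : B ⊂ B ∪ Q.support.toFinset :=
      (Finset.ssubset_iff_of_subset hsub).2 ⟨b, hbU, hbB⟩
    have := Finset.card_lt_card this
    omega
  · refine patch G B _ (by exact_mod_cast hsub) hconn ?_
    intro t ht
    rw [Finset.mem_coe, Finset.mem_union, List.mem_toFinset] at ht
    rcases ht with ht | ht
    · exact ⟨B, by exact_mod_cast hsub, ht, ⟨t, ht, ht⟩, hconn⟩
    · refine ⟨{a | a ∈ Q.support}, ?_, ht, ⟨x, Q.start_mem_support, hxB⟩,
        Q.connected_induce_support⟩
      intro a ha
      simp at ha ⊢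
      exact Or.inr ha
  · intro d _
    have hsub' : B.erase d ⊆ (B ∪ Q.support.toFinset).erase d := Finset.erase_subset_erase d hsub
    refine patch G (B.erase d : Finset V) _ (by exact_mod_cast hsub') (herase d) ?_
    intro t ht
    rw [Finset.mem_coe, Finset.mem_erase, Finset.mem_union, List.mem_toFinset] at ht
    obtain ⟨htd, ht⟩ := ht
    rcases ht with ht | ht
    · have : t ∈ ((B.erase d : Finset V) : Set V) := by simp [ht, htd]
      exact ⟨_, by exact_mod_cast hsub', this, ⟨t, this, this⟩, herase d⟩
    · obtain ⟨s, hs1, hs2, hs3, hs4, hs5⟩ := path_avoid G Q hQ t d ht htd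
      refine ⟨s, ?_, hs2, ?_, hs5⟩
      · intro a ha
        have : a ≠ d := fun h => hs3 (h ▸ ha)
        simp [this, hs1 a ha]
      · rcases hs4 with h | h
        · have : x ≠ d := fun e => hs3 (e ▸ h)
          exact ⟨x, h, by simp [this]; exact hxB⟩
        · have : y ≠ d := fun e => hs3 (e ▸ h)
          exact ⟨y, h, by simp [this]; exact hyB⟩

/-- `f` is a retraction onto `S`, constant along edges not inside `S`. -/
def Gated {V : Type*} (G : SimpleGraph V) (S : Set V) (f : V → V) : Prop :=
  (∀ w, f w ∈ S) ∧ (∀ w ∈ S, f w = w) ∧ ∀ a b, G.Adj a b → a ∉ S → f a = f b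

theorem gate_exists {V : Type*} (G : SimpleGraph V) (B : Set V) {w x : V} (q : G.Walk w x)
    (hx : x ∈ B) : ∃ y, Gate G B w y := by
  induction q with
  | nil => exact ⟨_, hx, SimpleGraph.Walk.nil, by simp⟩
  | @cons a b c hadj q ih =>
    by_cases ha : a ∈ B
    · exact ⟨a, ha, SimpleGraph.Walk.nil, by simp⟩
    · obtain ⟨y, hy, q', hq'⟩ := ih hx
      refine ⟨y, hy, SimpleGraph.Walk.cons hadj q', ?_⟩
      intro z hz hzB
      rw [SimpleGraph.Walk.support_cons, List.mem_cons] at hz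
      rcases hz with rfl | hz
      · exact absurd hzB ha
      · exact hq' z hz hzB

theorem block_gated {V : Type*} [DecidableEq V] (G : SimpleGraph V) (hconn : G.Connected)
    (B : Finset V) (hB : IsBlock G B) : ∃ f, Gated G (B : Set V) f := by
  obtain ⟨hcard, -, -⟩ := block_facts G B hB.1
  obtain ⟨x0, hx0⟩ : B.Nonempty := Finset.card_pos.1 (by omega)
  have hex : ∀ w, ∃ y, Gate G (B : Set V) w y := fun w => by
    obtain ⟨q⟩ := hconn.preconnected w x0
    exact gate_exists G _ q hx0
  choose f hf using hex
  refine ⟨f, fun w => (hf w).1, ?_, ?_⟩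
  · intro w hw
    obtain ⟨_, q, hq⟩ := hf w
    exact (hq w q.start_mem_support hw).symm
  · intro a b hab ha
    obtain ⟨hb, q, hq⟩ := hf b
    refine gate_unique G B hB a _ _ (hf a) ⟨hb, SimpleGraph.Walk.cons hab q, ?_⟩
    intro z hz hzB
    rw [SimpleGraph.Walk.support_cons, List.mem_cons] at hz
    rcases hz with rfl | hz
    · exact absurd hzB ha
    · exact hq z hz hzB

theorem gated_mem {V : Type*} (G : SimpleGraph V) (S T : Set V) (f : V → V)
    (hf : Gated G S f) (hT : (G.induce T).Connected) (hST : (S ∩ T).Nonempty) (b : V)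
    (hb : b ∈ T) : f b ∈ T := by
  obtain ⟨s, hsS, hsT⟩ := hST
  obtain ⟨q⟩ := hT.preconnected ⟨b, hb⟩ ⟨s, hsT⟩
  have : ∀ (a c : T) (q : (G.induce T).Walk a c), (c : V) ∈ S → f a ∈ T := by
    intro a c q hc
    induction q with
    | nil => rw [hf.2.1 _ hc]; exact Subtype.property _
    | @cons a b c hadj q ih =>
      by_cases ha : (a : V) ∈ S
      · rw [hf.2.1 _ ha]; exact a.2
      · rw [hf.2.2 a b hadj ha]; exact ih hc
  exact this _ _ q hsS

theorem gated_union {V : Type*} (G : SimpleGraph V) (S T : Set V) (f g : V → V)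
    (hf : Gated G S f) (hg : Gated G T g) (hT : (G.induce T).Connected)
    (hST : (S ∩ T).Nonempty) : ∃ h, Gated G (S ∪ T) h := by
  classical
  refine ⟨fun a => if a ∈ S ∪ T then a else if f a ∈ T then g a else f a, ?_, ?_, ?_⟩
  · intro w
    dsimp only
    split_ifs with h1 h2
    · exact h1
    · exact Or.inr (hg.1 w)
    · exact Or.inl (hf.1 w)
  · intro w hw
    simp only [if_pos hw]
  · intro a b hab ha
    have haS : a ∉ S := fun h => ha (Or.inl h)
    have haT : a ∉ T := fun h => ha (Or.inr h)
    have e1 := hf.2.2 a b hab haS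
    have e2 := hg.2.2 a b hab haT
    simp only [if_neg ha]
    by_cases hb : b ∈ S ∪ T
    · simp only [if_pos hb]
      by_cases hbT : b ∈ T
      · rw [e1, if_pos (gated_mem G S T f hf hT hST b hbT), e2, hg.2.1 b hbT]
      · have hbS : b ∈ S := hb.resolve_right hbT
        rw [e1, hf.2.1 b hbS, if_neg hbT]
    · simp only [if_neg hb]
      rw [e1, e2]

theorem chain_gated {V : Type*} [DecidableEq V] (G : SimpleGraph V) (hconn : G.Connected) :
    ∀ (r : ℕ) (C : Fin (r + 1) → Finset V), (∀ j, IsBlock G (C j)) →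
    (∀ j : Fin r, ((C j.castSucc) ∩ (C j.succ)).Nonempty) →
    ∃ f, Gated G {w | ∃ j, w ∈ C j} f := by
  intro r
  induction r with
  | zero =>
    intro C hC _
    obtain ⟨f, hf⟩ := block_gated G hconn (C 0) (hC 0)
    refine ⟨f, ?_⟩
    convert hf using 1
    ext w
    simp
  | succ r ih =>
    intro C hC hch
    obtain ⟨f, hf⟩ := ih (fun j => C j.castSucc) (fun j => hC _) (fun j => by
      have := hch j.castSucc
      simpa using this)
    obtain ⟨g, hg⟩ := block_gated G hconn (C (Fin.last _)) (hC _)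
    obtain ⟨h, hh⟩ := gated_union G _ _ f g hf hg (block_facts G _ (hC _).1).2.1 (by
      obtain ⟨z, hz⟩ := hch (Fin.last r)
      rw [Finset.mem_inter] at hz
      exact ⟨z, ⟨_, hz.1⟩, by simpa using hz.2⟩)
    refine ⟨h, ?_⟩
    convert hh using 1
    ext w
    constructor
    · rintro ⟨j, hj⟩
      refine Fin.lastCases (motive := fun j => w ∈ C j → _) ?_ ?_ j hj
      · intro h; exact Or.inr h
      · intro i h; exact Or.inl ⟨i, h⟩
    · rintro (⟨j, hj⟩ | hj)
      · exact ⟨_, hj⟩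
      · exact ⟨_, hj⟩

/-- Rewriting of the chip count as a sum of differences. -/
theorem topple_eq {V : Type*} [Fintype V] (G : SimpleGraph V) [DecidableRel G.Adj]
    (c u : V → ℕ) (v : V) :
    SandpileToppleVal G c u v = (c v : ℤ) + ∑ w : V, if G.Adj w v then (u w : ℤ) - u v else 0 := by
  have h : (G.degree v : ℤ) * (u v : ℤ) = ∑ w : V, if G.Adj w v then (u v : ℤ) else 0 := by
    rw [← Finset.sum_filter, Finset.sum_const, nsmul_eq_mul, ← G.card_neighborFinset_eq_degree]
    congr 3
    ext w
    simp [G.adj_comm]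
  unfold SandpileToppleVal
  rw [h, add_sub_assoc, ← Finset.sum_sub_distrib]
  congr 1
  apply Finset.sum_congr rfl
  intro w _
  split_ifs <;> simp

theorem least_action_aux {V : Type*} [Fintype V] [DecidableEq V] (G : SimpleGraph V)
    [DecidableRel G.Adj] (p : V) (c : V → ℕ) :
    ∀ (n : ℕ) (u : V → ℕ), ∑ w, u w = n → u p = 0 →
    (∀ v, v ≠ p → SandpileToppleVal G c u v < G.degree v) →
    ∃ u' : V → ℕ, u' p = 0 ∧ (∀ v, v ≠ p → 0 ≤ SandpileToppleVal G c u' v ∧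
      SandpileToppleVal G c u' v < G.degree v) ∧ ∀ v, u' v ≤ u v := by
  intro n
  induction n using Nat.strong_induction_on with
  | _ n ih =>
    intro u hn hp hst
    by_cases hneg : ∀ v, v ≠ p → 0 ≤ SandpileToppleVal G c u v
    · exact ⟨u, hp, fun v hv => ⟨hneg v hv, hst v hv⟩, fun _ => le_rfl⟩
    · push Not at hneg
      obtain ⟨z, hz, hzneg⟩ := hneg
      have hle0 : (0 : ℤ) ≤ ∑ w : V, if G.Adj w z then (u w : ℤ) else 0 :=
        Finset.sum_nonneg fun w _ => by split_ifs <;> positivity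
      have hpos : 0 < u z := by
        rcases Nat.eq_zero_or_pos (u z) with h | h
        · exfalso
          unfold SandpileToppleVal at hzneg
          rw [h] at hzneg
          push_cast at hzneg
          have : (0 : ℤ) ≤ c z := by positivity
          linarith
        · exact h
      obtain ⟨t, ht⟩ : ∃ t : V → ℕ, t = Function.update u z (u z - 1) := ⟨_, rfl⟩
      have htz : t z = u z - 1 := by simp [ht]
      have htn : ∀ a, a ≠ z → t a = u a := fun a ha => by simp [ht, ha]
      have htle : ∀ a, t a ≤ u a := by
        intro a
        by_cases ha : a = z
        · subst ha; omega
        · exact (htn a ha).le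
      have hsumle : ∀ a, (∑ w : V, if G.Adj w a then (t w : ℤ) else 0) ≤
          ∑ w : V, if G.Adj w a then (u w : ℤ) else 0 := by
        intro a
        apply Finset.sum_le_sum
        intro w _
        split_ifs
        · exact_mod_cast htle w
        · exact le_rfl
      obtain ⟨u', h1, h2, h3⟩ := ih (∑ w, t w) (by
        rw [← hn]
        exact Finset.sum_lt_sum (fun w _ => htle w) ⟨z, Finset.mem_univ _, by omega⟩) t rfl
        (by rw [htn p hz.symm, hp]) (by
          intro a ha
          have hs := hsumle a
          by_cases haz : a = z
          · subst haz
            unfold SandpileToppleVal at hzneg ⊢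
            rw [htz, Nat.cast_sub hpos]
            push_cast
            linarith
          · have := hst a ha
            unfold SandpileToppleVal at this ⊢
            rw [htn a haz]
            linarith)
      exact ⟨u', h1, h2, fun a => (h3 a).trans (htle a)⟩

theorem least_action {V : Type*} [Fintype V] [DecidableEq V] (G : SimpleGraph V)
    [DecidableRel G.Adj] (p : V) (c u u' : V → ℕ) (hu : SandpileIsOdometer G p c u)
    (hp : u' p = 0) (hst : ∀ v, v ≠ p → SandpileToppleVal G c u' v < G.degree v) :
    ∀ v, u v ≤ u' v := by
  obtain ⟨u'', h1, h2, h3⟩ := least_action_aux G p c _ u' rfl hp hst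
  exact fun v => (hu.2.2 u'' h1 h2 v).trans (h3 v)

theorem ncard_eq {V : Type*} [Fintype V] (G : SimpleGraph V) [DecidableRel G.Adj] (v : V) :
    {w | G.Adj w v}.ncard = G.degree v := by
  rw [← G.card_neighborFinset_eq_degree, ← Set.ncard_coe_finset]
  congr 1
  ext w
  simp [G.adj_comm]

theorem odometer_const {V : Type*} [Fintype V] [DecidableEq V] (G : SimpleGraph V)
    [DecidableRel G.Adj] (p v : V) (S : Set V) (f : V → V) (hf : Gated G S f)
    (hp : p ∈ S) (hv : v ∈ S) (c u : V → ℕ)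
    (hs : SandpileStable G p c) (hr : SandpileRecurrent G p c)
    (hu : SandpileIsOdometer G p (fun w => c w + if w = v then 1 else 0) u) :
    ∀ w, u w = u (f w) := by
  classical
  obtain ⟨ord, -, -, hord⟩ := hr
  have hlow : ∀ w, u (f w) ≤ u w := by
    by_contra hcon
    push Not at hcon
    obtain ⟨w0, hw0⟩ := hcon
    obtain ⟨x, hx⟩ : ∃ x, x = f w0 := ⟨_, rfl⟩
    have hA : (Finset.univ.filter fun w => f w = x ∧ u w < u x).Nonempty :=
      ⟨w0, by simp [hx, hw0]⟩
    obtain ⟨w1, hw1, hmin1⟩ := Finset.exists_min_image _ u hA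
    have hA2 : (Finset.univ.filter fun w => f w = x ∧ u w = u w1).Nonempty :=
      ⟨w1, by simpa using (by simpa using hw1 : f w1 = x ∧ u w1 < u x).1⟩
    obtain ⟨w, hw, hmin2⟩ := Finset.exists_min_image _ ord hA2
    simp only [Finset.mem_filter, Finset.mem_univ, true_and] at hw1 hmin1 hw hmin2
    have hwS : w ∉ S := by
      intro h
      have := hf.2.1 w h
      have h3 : w = x := by rw [← this, hw.1]
      have h4 := hw.2
      rw [h3] at h4
      omega
    have hwp : w ≠ p := fun h => hwS (h ▸ hp)
    have hwv : w ≠ v := fun h => hwS (h ▸ hv)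
    have hst := (hu.2.1 w hwp).2
    rw [topple_eq] at hst
    have hrec := hord w hwp
    rw [ncard_eq] at hrec
    have hcount : (({z | G.Adj z w ∧ ord z < ord w}.ncard : ℕ) : ℤ) =
        ∑ z : V, if G.Adj z w ∧ ord z < ord w then (1 : ℤ) else 0 := by
      rw [Finset.sum_boole, ← Set.ncard_coe_finset]
      simp
    have hle : (∑ z : V, if G.Adj z w ∧ ord z < ord w then (1 : ℤ) else 0) ≤
        ∑ z : V, if G.Adj z w then (u z : ℤ) - u w else 0 := by
      apply Finset.sum_le_sum
      intro z _
      by_cases hz : G.Adj z w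
      · have hfz : f z = x := by rw [← hw.1]; exact (hf.2.2 w z hz.symm hwS).symm
        have hge : u w ≤ u z := by
          by_cases h : u z < u x
          · have := hmin1 z ⟨hfz, h⟩; omega
          · omega
        by_cases ho : ord z < ord w
        · have hgt : u w < u z := by
            rcases Nat.lt_or_ge (u w) (u z) with h | h
            · exact h
            · have := hmin2 z ⟨hfz, by omega⟩
              omega
          simp only [hz, ho, and_self, if_true]
          omega
        · simp only [hz, ho, and_false, if_true, if_false]
          omega
      · simp [hz]
    simp only [hwv, if_false, add_zero] at hst
    have : (G.degree w : ℤ) ≤ c w + ({z | G.Adj z w ∧ ord z < ord w}.ncard : ℕ) := by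
      exact_mod_cast hrec
    rw [hcount] at this
    linarith
  have hidem : ∀ w, f (f w) = f w := fun w => hf.2.1 _ (hf.1 w)
  have hup := least_action G p _ u (fun w => u (f w)) hu
    (by show u (f p) = 0; rw [hf.2.1 p hp]; exact hu.1) (by
      intro w hw
      by_cases hwS : w ∈ S
      · refine lt_of_le_of_lt ?_ (hu.2.1 w hw).2
        rw [topple_eq, topple_eq]
        gcongr with z
        split_ifs
        · rw [hf.2.1 w hwS]
          have := hlow z
          omega
        · exact le_rfl
      · have hwv : w ≠ v := fun h => hwS (h ▸ hv)
        rw [topple_eq]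
        have h0 : (∑ z : V, if G.Adj z w then ((u (f z) : ℕ) : ℤ) - (u (f w) : ℕ) else 0) = 0 := by
          apply Finset.sum_eq_zero
          intro z _
          split_ifs with hz
          · rw [hf.2.2 w z hz.symm hwS]; simp
          · rfl
        rw [h0]
        have := hs w hw
        rw [ncard_eq] at this
        simp only [hwv, if_false, add_zero]
        exact_mod_cast this)
  exact fun w => le_antisymm (hup w) (hlow w)

theorem odometer_le {V : Type*} [Fintype V] [DecidableEq V] (G : SimpleGraph V)
    [DecidableRel G.Adj] (p v : V) (S : Set V) (f : V → V) (hf : Gated G S f)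
    (hv : v ∈ S) (c₁ c₂ u₁ u₂ : V → ℕ)
    (hs : SandpileStable G p c₁) (hag : ∀ w ∈ S, c₁ w = c₂ w)
    (hc : ∀ w, u₂ w = u₂ (f w))
    (hu₁ : SandpileIsOdometer G p (fun w => c₁ w + if w = v then 1 else 0) u₁)
    (hu₂ : SandpileIsOdometer G p (fun w => c₂ w + if w = v then 1 else 0) u₂) :
    ∀ w, u₁ w ≤ u₂ w := by
  refine least_action G p _ u₁ u₂ hu₁ hu₂.1 ?_
  intro w hw
  by_cases hwS : w ∈ S
  · have := (hu₂.2.1 w hw).2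
    unfold SandpileToppleVal at this ⊢
    simp only [hag w hwS]
    exact this
  · have hwv : w ≠ v := fun h => hwS (h ▸ hv)
    rw [topple_eq]
    have h0 : (∑ z : V, if G.Adj z w then (u₂ z : ℤ) - u₂ w else 0) = 0 := by
      apply Finset.sum_eq_zero
      intro z _
      split_ifs with hz
      · rw [hc z, hc w, hf.2.2 w z hz.symm hwS]; simp
      · rfl
    rw [h0]
    have := hs w hw
    rw [ncard_eq] at this
    simp only [hwv, if_false, add_zero]
    exact_mod_cast this

end SandAux

/-- On a finite connected separable graph with dissipative vertex `p`, let
`C 0, …, C r` be the (unique, minimal) block-path joining the vertex `v` to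
`p`.  The avalanche triggered by adding one chip at `v` to a recurrent
configuration depends only on the restrictions of the configuration to the
blocks of this block-path: if two recurrent configurations agree on all these
blocks, the corresponding odometers (firing multiplicities) coincide. -/
theorem sandpile_avalanche_depends_only_on_blockpath
    [Fintype V] [DecidableEq V]
    (G : SimpleGraph V) [DecidableRel G.Adj]
    (hconn : G.Connected) (hsep : Separable G)
    (p v : V) (hvp : v ≠ p)
    (r : ℕ) (C : Fin (r + 1) → Finset V)
    (hblock : ∀ j, IsBlock G (C j)) (hinj : Function.Injective C)
    (hchain : ∀ j : Fin r, ((C j.castSucc) ∩ (C j.succ)).Nonempty)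
    (hv : v ∈ C 0) (hp : p ∈ C (Fin.last r))
    (hmin : ∀ (r' : ℕ) (C' : Fin (r' + 1) → Finset V),
      (∀ j, IsBlock G (C' j)) → Function.Injective C' →
      (∀ j : Fin r', ((C' j.castSucc) ∩ (C' j.succ)).Nonempty) →
      v ∈ C' 0 → p ∈ C' (Fin.last r') → r ≤ r')
    (c₁ c₂ : V → ℕ)
    (h₁ : SandpileStable G p c₁ ∧ SandpileRecurrent G p c₁)
    (h₂ : SandpileStable G p c₂ ∧ SandpileRecurrent G p c₂)
    (hagree : ∀ j, ∀ w ∈ C j, c₁ w = c₂ w)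
    (u₁ u₂ : V → ℕ)
    (hu₁ : SandpileIsOdometer G p (fun w => c₁ w + if w = v then 1 else 0) u₁)
    (hu₂ : SandpileIsOdometer G p (fun w => c₂ w + if w = v then 1 else 0) u₂) :
    u₁ = u₂ := by
  obtain ⟨f, hf⟩ := SandAux.chain_gated G hconn r C hblock hchain
  have hvS : v ∈ {w | ∃ j, w ∈ C j} := ⟨0, hv⟩
  have hpS : p ∈ {w | ∃ j, w ∈ C j} := ⟨_, hp⟩
  have e1 := SandAux.odometer_const G p v _ f hf hpS hvS c₁ u₁ h₁.1 h₁.2 hu₁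
  have e2 := SandAux.odometer_const G p v _ f hf hpS hvS c₂ u₂ h₂.1 h₂.2 hu₂
  have hag : ∀ w ∈ {w | ∃ j, w ∈ C j}, c₁ w = c₂ w := by
    rintro w ⟨j, hj⟩
    exact hagree j w hj
  funext w
  exact le_antisymm
    (SandAux.odometer_le G p v _ f hf hvS c₁ c₂ u₁ u₂ h₁.1 hag e2 hu₁ hu₂ w)
    (SandAux.odometer_le G p v _ f hf hvS c₂ c₁ u₂ u₁ h₂.1 (fun w hw => (hag w hw).symm)
      e1 hu₂ hu₁ w)
end

section
/- The critical group (sandpile group) of the n-th Basilica Schreier graph Γ_n is isomorphic to the direct product over all cycles C of Γ_n of the cyclic groups Z/|C|Z. Explicitly, for even n it is ∏_{k=1}^{n/2−1} (Z/2^k Z)^{3·2^{n−2k−1}} × (Z/2^{n/2} Z)^3, and for odd n it is ∏_{k=1}^{⌊n/2⌋−1} (Z/2^k Z)^{3·2^{n−2k−1}} × (Z/2^{⌊n/2⌋} Z)^4 × (Z/2^{⌈n/2⌉} Z). -/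
/-- The Basilica automorphisms of the binary rooted tree, acting on finite
binary words (`false` = 0, `true` = 1): `bas false` is the generator
`a = e(b, id)` and `bas true` is the generator `b = (01)(a, id)`. -/
def bas : Bool → List Bool → List Bool
  | _, [] => []
  | false, false :: w => false :: bas true w
  | false, true :: w => true :: w
  | true, false :: w => true :: bas false w
  | true, true :: w => false :: w

/-- Edge multiplicity between two vertices of the `n`-th Basilica Schreier
graph `Γ_n` (vertices are binary words of length `n`, encoded as functions
`Fin n → Bool`): each generator `g ∈ {a, b}` contributes one edge `v — g(v)`
for every vertex `v`. -/
def basMult (n : ℕ) (v w : Fin n → Bool) : ℕ :=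
  (if bas false (List.ofFn v) = List.ofFn w then 1 else 0) +
  (if bas false (List.ofFn w) = List.ofFn v then 1 else 0) +
  (if bas true (List.ofFn v) = List.ofFn w then 1 else 0) +
  (if bas true (List.ofFn w) = List.ofFn v then 1 else 0)

/-- The row of the (multigraph) Laplacian of `Γ_n` at the vertex `v`:
diagonal entry the number of edges from `v` to other vertices (loops do not
count), off-diagonal entries minus the edge multiplicities. -/
def basLapRow (n : ℕ) (v : Fin n → Bool) : (Fin n → Bool) → ℤ :=
  fun w =>
    if w = v then (∑ u : Fin n → Bool, if u = v then 0 else (basMult n v u : ℤ))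
    else -(basMult n v w : ℤ)

/-- The subgroup of relations defining the critical group: the span of the
Laplacian rows together with the delta function at the sink `0ⁿ`. -/
def basCritRel (n : ℕ) : Submodule ℤ ((Fin n → Bool) → ℤ) :=
  Submodule.span ℤ
    ({f | ∃ v, f = basLapRow n v} ∪
      {fun w => if w = (fun _ => false) then 1 else 0})

/-- The critical group (sandpile group) of the `n`-th Basilica Schreier graph:
`ℤ^{V(Γ_n)}` modulo the Laplacian rows and the delta function at the sink. -/
abbrev BasilicaCriticalGroup (n : ℕ) :=
  ((Fin n → Bool) → ℤ) ⧸ basCritRel n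

section BasAbstract

lemma basX_sum_perm {V K : Type*} [Fintype V] [AddCommGroup K] (σ : Equiv.Perm V) (f : V → K) :
    ∑ v, f (σ v) = ∑ v, f v := Equiv.sum_comp σ f

/-- Cut argument: all edges of one cycle have the same difference, of order dividing the length. -/
lemma basX_cut {V I K : Type*} {G : Type*} [Fintype G] [DecidableEq G] [Fintype V] [DecidableEq V]
    [DecidableEq I] [AddCommGroup K] (σ : G → Equiv.Perm V) (l : I → ℕ) [∀ i, NeZero (l i)]
    (cls : G → V → I) (F : (i : I) → V → ZMod (l i))
    (H1 : ∀ i g v, F i (σ g v) = F i v + if cls g v = i then 1 else 0)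
    (H2 : ∀ i g v g' v', cls g v = i → cls g' v' = i → F i v = F i v' → g = g' ∧ v = v')
    (H5 : ∀ g v, cls g (σ g v) = cls g v)
    (x : V → K) (hx : ∀ v, ∑ g, ((x v - x ((σ g).symm v)) - (x (σ g v) - x v)) = 0) (i : I) :
    ∃ Y : K, (l i) • Y = 0 ∧ ∀ g v, cls g v = i → x (σ g v) - x v = Y := by
  set D : G → V → K := fun g v => x (σ g v) - x v with hD
  have cut : ∀ h : V → ℤ, ∑ g, ∑ v, (h (σ g v) - h v) • D g v = 0 := by
    intro h
    have h1 : ∑ v, h v • ∑ g, ((x v - x ((σ g).symm v)) - (x (σ g v) - x v)) = 0 := by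
      simp [hx]
    simp only [Finset.smul_sum] at h1
    rw [Finset.sum_comm] at h1
    rw [← h1]
    refine Finset.sum_congr rfl fun g _ => ?_
    simp only [sub_smul, smul_sub (h _) (_ - _) (_ - _), Finset.sum_sub_distrib]
    congr 1
    rw [← basX_sum_perm (σ g) (fun v => h v • (x v - x ((σ g).symm v)))]
    simp [hD]
  set Y : ZMod (l i) → K := fun c =>
    ∑ g, ∑ v, if cls g v = i ∧ F i v = c then D g v else 0 with hY
  have step : ∀ c, Y (c + 1) = Y c := by
    intro c
    have := cut (fun v => if F i v = c + 1 then 1 else 0)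
    rw [eq_comm, ← sub_eq_zero, ← this, hY]
    simp only [← Finset.sum_sub_distrib]
    refine Finset.sum_congr rfl fun g _ => Finset.sum_congr rfl fun v _ => ?_
    rw [H1]
    by_cases hc : cls g v = i
    · simp only [hc, true_and, if_true, add_left_inj, sub_smul, ite_smul, one_smul, zero_smul]
    · simp [hc]
  have const : ∀ c, Y c = Y 0 := by
    intro c
    have : ∀ m : ℕ, Y (m : ZMod (l i)) = Y 0 := by
      intro m
      induction m with
      | zero => simp
      | succ m ih => push_cast; rw [step, ih]
    rw [← ZMod.natCast_zmod_val c, this]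
  refine ⟨Y 0, ?_, ?_⟩
  · have : ∑ c, Y c = (l i) • Y 0 := by
      simp [const, ZMod.card]
    rw [← this, hY]
    rw [Finset.sum_comm]
    refine Finset.sum_eq_zero fun g _ => ?_
    rw [Finset.sum_comm]
    have : ∀ v, (∑ c, if cls g v = i ∧ F i v = c then D g v else 0) =
        (if cls g (σ g v) = i then x (σ g v) else 0) - (if cls g v = i then x v else 0) := by
      intro v
      rw [H5]
      by_cases hc : cls g v = i <;> simp [hc, hD]
    simp only [this, Finset.sum_sub_distrib]
    rw [basX_sum_perm (σ g) (fun v => if cls g v = i then x v else 0), sub_self]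
  · intro g v hgv
    rw [← const (F i v), hY]
    simp only
    rw [Finset.sum_eq_single g, Finset.sum_eq_single v]
    · simp [hgv, hD]
    · intro v' _ hv'
      rw [if_neg]
      rintro ⟨h1, h2⟩
      exact hv' (H2 i g v' g v h1 hgv h2).2
    · simp
    · intro g' _ hg'
      refine Finset.sum_eq_zero fun v' _ => ?_
      rw [if_neg]
      rintro ⟨h1, h2⟩
      exact hg' (H2 i g' v' g v h1 hgv h2).1
    · simp

lemma basX_main {V I G : Type} [Fintype G] [DecidableEq G] [Fintype V] [DecidableEq V]
    [Fintype I] [DecidableEq I] (σ : G → Equiv.Perm V) (l : I → ℕ) [∀ i, NeZero (l i)]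
    (cls : G → V → I) (F : (i : I) → V → ZMod (l i))
    (H1 : ∀ i g v, F i (σ g v) = F i v + if cls g v = i then 1 else 0)
    (H2 : ∀ i g v g' v', cls g v = i → cls g' v' = i → F i v = F i v' → g = g' ∧ v = v')
    (H3 : ∀ i, ∃ g v, cls g v = i)
    (H4 : ∀ s : Set V, (∀ g v, σ g v ∈ s ↔ v ∈ s) → ∀ v w, v ∈ s → w ∈ s)
    (H5 : ∀ g v, cls g (σ g v) = cls g v)
    (v0 : V) (L : V → V → ℤ)
    (hL : ∀ v w, L v w = ∑ g, (2 * (if w = v then 1 else 0) - (if σ g v = w then 1 else 0) -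
      (if σ g w = v then 1 else 0))) :
    Nonempty (((V → ℤ) ⧸ Submodule.span ℤ
      ({f | ∃ v, f = L v} ∪ {fun w => if w = v0 then 1 else 0})) ≃+ ((i : I) → ZMod (l i))) := by
  set R := Submodule.span ℤ
      ({f | ∃ v, f = L v} ∪ {fun w => if w = v0 then (1:ℤ) else 0}) with hR
  -- evaluating a function against a Laplacian row
  have hsum : ∀ {K : Type _} [AddCommGroup K] (x : V → K) (v : V),
      ∑ w, L v w • x w = ∑ g, ((x v - x ((σ g).symm v)) - (x (σ g v) - x v)) := by
    intro K _ x v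
    simp only [hL, Finset.sum_smul]
    rw [Finset.sum_comm]
    refine Finset.sum_congr rfl fun g _ => ?_
    have e : ∀ w, (σ g w = v) ↔ (w = (σ g).symm v) := fun w => by
      rw [Equiv.eq_symm_apply]
    simp only [sub_smul, Finset.sum_sub_distrib, e, mul_smul, ite_smul, one_smul, zero_smul,
      ← Finset.smul_sum, Finset.sum_ite_eq, Finset.sum_ite_eq', Finset.mem_univ, if_true]
    rw [two_smul]; abel
  let Φ : (V → ℤ) →ₗ[ℤ] ((i : I) → ZMod (l i)) :=
    { toFun := fun f i => ∑ v, f v • (F i v - F i v0)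
      map_add' := by
        intro f f'; ext i; simp [add_mul, Finset.sum_add_distrib]
      map_smul' := by
        intro c f; ext i; simp [Finset.mul_sum, mul_assoc] }
  have hΦ : ∀ f i, Φ f i = ∑ v, f v • (F i v - F i v0) := fun _ _ => rfl
  have hRΦ : R ≤ LinearMap.ker Φ := by
    rw [hR, Submodule.span_le]
    rintro f (⟨v, rfl⟩ | hf)
    · rw [SetLike.mem_coe, LinearMap.mem_ker]
      ext i
      rw [hΦ, hsum (fun w => F i w - F i v0) v]
      refine Finset.sum_eq_zero fun g _ => ?_
      have a1 := H1 i g v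
      have a2 := H1 i g ((σ g).symm v)
      have a3 := H5 g ((σ g).symm v)
      rw [Equiv.apply_symm_apply] at a2 a3
      rw [a1, a2, ← a3]; abel
    · rw [Set.mem_singleton_iff] at hf
      subst hf
      rw [SetLike.mem_coe, LinearMap.mem_ker]
      ext i
      simp [hΦ]
  let x : V → (V → ℤ) ⧸ R := fun v => Submodule.Quotient.mk (Pi.single v 1)
  have hmk : ∀ f : V → ℤ, (Submodule.Quotient.mk f : (V → ℤ) ⧸ R) = ∑ v, f v • x v := by
    intro f
    have : f = ∑ v, f v • (Pi.single v (1:ℤ) : V → ℤ) := by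
      ext w; simp [Finset.sum_apply, Pi.single_apply]
    conv_lhs => rw [this]
    have := map_sum R.mkQ (fun v => f v • (Pi.single v (1:ℤ) : V → ℤ)) Finset.univ
    simp only [Submodule.mkQ_apply, Submodule.Quotient.mk_smul] at this
    exact this
  have hx : ∀ v, ∑ g, ((x v - x ((σ g).symm v)) - (x (σ g v) - x v)) = 0 := by
    intro v
    rw [← hsum, ← hmk, Submodule.Quotient.mk_eq_zero]
    exact Submodule.subset_span (Or.inl ⟨v, rfl⟩)
  have hx0 : x v0 = 0 := by
    rw [Submodule.Quotient.mk_eq_zero]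
    refine Submodule.subset_span (Or.inr ?_)
    ext w; simp [Pi.single_apply]
  have hY := fun i => basX_cut σ l cls F H1 H2 H5 x hx i
  choose Y hY0 hY1 using hY
  -- the Y's generate
  have hgen : ∀ q : (V → ℤ) ⧸ R, ∃ c : I → ℤ, q = ∑ i, c i • Y i := by
    have hspan : ∀ q : (V → ℤ) ⧸ R, q ∈ Submodule.span ℤ (Set.range Y) := by
      intro q
      obtain ⟨f, rfl⟩ := Submodule.Quotient.mk_surjective _ q
      rw [hmk]
      refine Submodule.sum_mem _ fun v _ => Submodule.smul_mem _ _ ?_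
      refine H4 {v | x v ∈ Submodule.span ℤ (Set.range Y)} ?_ v0 v ?_
      · intro g v
        have h1 := hY1 (cls g v) g v rfl
        have h2 : Y (cls g v) ∈ Submodule.span ℤ (Set.range Y) :=
          Submodule.subset_span ⟨_, rfl⟩
        have h3 : x (σ g v) = Y (cls g v) + x v := by rw [← h1]; abel
        simp only [Set.mem_ofPred_eq, h3]
        exact Submodule.add_mem_iff_right _ h2
      · simp [hx0]
    intro q
    obtain ⟨c, hc⟩ := (Submodule.mem_span_range_iff_exists_fun ℤ).1 (hspan q)
    exact ⟨c, hc.symm⟩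
  let Ψ := R.liftQ Φ hRΦ
  have hΨx : ∀ v, Ψ (x v) = fun i => F i v - F i v0 := by
    intro v
    ext i
    change Φ (Pi.single v 1) i = _
    rw [hΦ, Finset.sum_eq_single v]
    · simp
    · intro w _ hw; simp [hw]
    · simp
  have hΨY : ∀ i, Ψ (Y i) = Pi.single i 1 := by
    intro i
    obtain ⟨g, v, hgv⟩ := H3 i
    rw [← hY1 i g v hgv, map_sub, hΨx, hΨx]
    ext j
    simp only [Pi.sub_apply, H1, hgv]
    by_cases hij : i = j
    · subst hij; simp
    · simp [hij]
  have hΨc : ∀ (c : I → ℤ) j, Ψ (∑ i, c i • Y i) j = (c j : ZMod (l j)) := by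
    intro c j
    rw [map_sum]
    simp only [map_smul, hΨY, Finset.sum_apply, Pi.smul_apply]
    rw [Finset.sum_eq_single j]
    · simp
    · intro i _ hij; simp [Pi.single_eq_of_ne (Ne.symm hij)]
    · simp
  refine ⟨(AddEquiv.ofBijective Ψ ⟨?_, ?_⟩)⟩
  · rw [injective_iff_map_eq_zero]
    intro q hq
    obtain ⟨c, rfl⟩ := hgen q
    refine Finset.sum_eq_zero fun i _ => ?_
    have := congrFun hq i
    rw [hΨc, Pi.zero_apply, ZMod.intCast_zmod_eq_zero_iff_dvd] at this
    obtain ⟨d, hd⟩ := this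
    rw [hd, mul_comm, mul_smul]
    have := hY0 i
    rw [Nat.cast_smul_eq_nsmul, this, smul_zero]
  · intro t
    refine ⟨∑ i, ((t i).val : ℤ) • Y i, ?_⟩
    ext j
    rw [hΨc]; simp

end BasAbstract
section BasConcrete

/-- Words of length `n`, recursively. -/
def BasW : ℕ → Type
  | 0 => Unit
  | n + 1 => Bool × BasW n

/-- Cycles of the generator `g` at level `n`. -/
def BasC : Bool → ℕ → Type
  | _, 0 => Unit
  | false, n + 1 => BasC true n ⊕ BasW n
  | true, n + 1 => BasC false n

instance basW_fintype : ∀ n, Fintype (BasW n)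
  | 0 => inferInstanceAs (Fintype Unit)
  | n + 1 => by
    haveI := basW_fintype n
    exact inferInstanceAs (Fintype (Bool × BasW n))

instance basW_decEq : ∀ n, DecidableEq (BasW n)
  | 0 => inferInstanceAs (DecidableEq Unit)
  | n + 1 => by
    haveI := basW_decEq n
    exact inferInstanceAs (DecidableEq (Bool × BasW n))

instance basC_fintype : ∀ g n, Fintype (BasC g n)
  | false, 0 => inferInstanceAs (Fintype Unit)
  | true, 0 => inferInstanceAs (Fintype Unit)
  | false, n + 1 => by
    haveI := basC_fintype true n
    exact inferInstanceAs (Fintype (BasC true n ⊕ BasW n))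
  | true, n + 1 => by
    haveI := basC_fintype false n
    exact inferInstanceAs (Fintype (BasC false n))

instance basC_decEq : ∀ g n, DecidableEq (BasC g n)
  | false, 0 => inferInstanceAs (DecidableEq Unit)
  | true, 0 => inferInstanceAs (DecidableEq Unit)
  | false, n + 1 => by
    haveI := basC_decEq true n
    exact inferInstanceAs (DecidableEq (BasC true n ⊕ BasW n))
  | true, n + 1 => by
    haveI := basC_decEq false n
    exact inferInstanceAs (DecidableEq (BasC false n))

/-- The action on words. -/
def basAct : (n : ℕ) → Bool → BasW n → BasW n
  | 0, _, _ => ()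
  | n + 1, false, (false, w) => (false, basAct n true w)
  | _ + 1, false, (true, w) => (true, w)
  | n + 1, true, (false, w) => (true, basAct n false w)
  | _ + 1, true, (true, w) => (false, w)

/-- The cycle containing an edge. -/
def basCls : (n : ℕ) → (g : Bool) → BasW n → BasC g n
  | 0, false, _ => ()
  | 0, true, _ => ()
  | n + 1, false, (false, w) => Sum.inl (basCls n true w)
  | _ + 1, false, (true, w) => Sum.inr w
  | n + 1, true, (_, w) => basCls n false w

/-- Exponent of the cycle length. -/
def basEx : (n : ℕ) → (g : Bool) → BasC g n → ℕ
  | 0, false, _ => 0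
  | 0, true, _ => 0
  | n + 1, false, Sum.inl i => basEx n true i
  | _ + 1, false, Sum.inr _ => 0
  | n + 1, true, i => basEx n false i + 1

/-- Indicator of an edge being on a cycle. -/
def basInd (n : ℕ) (g : Bool) (w : BasW n) (i : BasC g n) : ℤ :=
  if basCls n g w = i then 1 else 0

lemma basInd_pos {n : ℕ} {g : Bool} {w : BasW n} {i : BasC g n} (h : basCls n g w = i) :
    basInd n g w i = 1 := if_pos h

lemma basInd_neg {n : ℕ} {g : Bool} {w : BasW n} {i : BasC g n} (h : ¬ basCls n g w = i) :
    basInd n g w i = 0 := if_neg h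

lemma basInd_congr {n m : ℕ} {g h : Bool} {w : BasW n} {i : BasC g n} {u : BasW m} {j : BasC h m}
    (e : basCls n g w = i ↔ basCls m h u = j) : basInd n g w i = basInd m h u j := by
  by_cases hh : basCls n g w = i
  · rw [basInd_pos hh, basInd_pos (e.1 hh)]
  · rw [basInd_neg hh, basInd_neg (fun h' => hh (e.2 h'))]

/-- Position (modulo the length) on a cycle of the projection of a vertex. -/
def basF : (n : ℕ) → (g : Bool) → BasC g n → BasW n → ℤ
  | 0, false, _, _ => 0
  | 0, true, _, _ => 0
  | n + 1, false, Sum.inl i, (_, w) => basF n true i w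
  | _ + 1, false, Sum.inr _, _ => 0
  | n + 1, true, i, (false, w) => 2 * basF n false i w
  | n + 1, true, i, (true, w) => 2 * basF n false i w - basInd n false w i

lemma basAct_inj : ∀ n g, Function.Injective (basAct n g)
  | 0, _ => fun _ _ _ => rfl
  | n + 1, false => by
    rintro ⟨x, w⟩ ⟨y, u⟩ h
    have h1 := congrArg Prod.fst h
    have h2 := congrArg Prod.snd h
    cases x <;> cases y
    · exact congrArg (Prod.mk false) (basAct_inj n true h2)
    · cases h1
    · cases h1
    · exact congrArg (Prod.mk true) h2
  | n + 1, true => by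
    rintro ⟨x, w⟩ ⟨y, u⟩ h
    have h1 := congrArg Prod.fst h
    have h2 := congrArg Prod.snd h
    cases x <;> cases y
    · exact congrArg (Prod.mk false) (basAct_inj n false h2)
    · cases h1
    · cases h1
    · exact congrArg (Prod.mk true) h2

lemma basCls_act : ∀ n g w, basCls n g (basAct n g w) = basCls n g w
  | 0, false, _ => rfl
  | 0, true, _ => rfl
  | n + 1, false, (false, w) => congrArg Sum.inl (basCls_act n true w)
  | _ + 1, false, (true, _) => rfl
  | n + 1, true, (false, w) => basCls_act n false w
  | _ + 1, true, (true, _) => rfl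

lemma basCls_surj : ∀ n g i, ∃ w, basCls n g w = i
  | 0, false, _ => ⟨(), rfl⟩
  | 0, true, _ => ⟨(), rfl⟩
  | n + 1, false, Sum.inl i => by
    obtain ⟨w, hw⟩ := basCls_surj n true i
    exact ⟨(false, w), congrArg Sum.inl hw⟩
  | _ + 1, false, Sum.inr w => ⟨(true, w), rfl⟩
  | n + 1, true, i => by
    obtain ⟨w, hw⟩ := basCls_surj n false i
    exact ⟨(false, w), hw⟩

lemma basX_dbl {e : ℕ} {a b : ℤ} (h : a ≡ b [ZMOD 2 ^ e]) :
    2 * a ≡ 2 * b [ZMOD 2 ^ (e + 1)] := by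
  rw [pow_succ']; exact Int.ModEq.mul_left' h

lemma basX_modEq_of_eq {m a b : ℤ} (h : a = b) : a ≡ b [ZMOD m] := h ▸ Int.ModEq.refl _

lemma basF_same : ∀ n g i w, basF n g i (basAct n g w) ≡
      basF n g i w + basInd n g w i [ZMOD 2 ^ basEx n g i]
  | 0, false, _, _ => by simp [basEx, Int.modEq_one]
  | 0, true, _, _ => by simp [basEx, Int.modEq_one]
  | n + 1, false, Sum.inl i, (false, w) => by
    have := basF_same n true i w
    have e : basInd (n + 1) false (false, w) (Sum.inl i) = basInd n true w i :=
      basInd_congr ⟨fun h => Sum.inl_injective h, fun h => congrArg Sum.inl h⟩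
    rw [e]
    exact this
  | n + 1, false, Sum.inl i, (true, w) => by
    have e : basInd (n + 1) false (true, w) (Sum.inl i) = 0 :=
      basInd_neg (by intro h; cases h)
    rw [e, add_zero]
    rfl
  | _ + 1, false, Sum.inr _, _ => by simp [basEx, Int.modEq_one]
  | n + 1, true, i, (false, w) => by
    have := basX_dbl (basF_same n false i w)
    have h2 := this.sub_right (basInd n false w i)
    have e : basInd (n + 1) true (false, w) i = basInd n false w i := basInd_congr Iff.rfl
    have e2 : basInd n false (basAct n false w) i = basInd n false w i :=
      basInd_congr (by rw [basCls_act])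
    rw [e]
    change 2 * basF n false i (basAct n false w) - basInd n false (basAct n false w) i ≡
      2 * basF n false i w + basInd n false w i [ZMOD 2 ^ (basEx n false i + 1)]
    rw [e2]
    refine h2.trans (basX_modEq_of_eq ?_)
    ring
  | n + 1, true, i, (true, w) => by
    have e : basInd (n + 1) true (true, w) i = basInd n false w i := basInd_congr Iff.rfl
    rw [e]
    change 2 * basF n false i w ≡
      2 * basF n false i w - basInd n false w i + basInd n false w i
        [ZMOD 2 ^ (basEx n false i + 1)]
    refine basX_modEq_of_eq ?_
    ring

lemma basF_diff : ∀ n g i w, basF n g i (basAct n (!g) w) ≡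
      basF n g i w [ZMOD 2 ^ basEx n g i]
  | 0, false, _, _ => by simp [basEx, Int.modEq_one]
  | 0, true, _, _ => by simp [basEx, Int.modEq_one]
  | n + 1, false, Sum.inl i, (false, w) => basF_diff n true i w
  | n + 1, false, Sum.inl i, (true, w) => Int.ModEq.refl _
  | _ + 1, false, Sum.inr _, _ => by simp [basEx, Int.modEq_one]
  | n + 1, true, i, (false, w) => basX_dbl (basF_diff n false i w)
  | n + 1, true, i, (true, w) => Int.ModEq.refl _

lemma basF_inj : ∀ n g i w w', basCls n g w = i → basCls n g w' = i →
      basF n g i w ≡ basF n g i w' [ZMOD 2 ^ basEx n g i] → w = w'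
  | 0, false, _, _, _ => fun _ _ _ => rfl
  | 0, true, _, _, _ => fun _ _ _ => rfl
  | n + 1, false, Sum.inl i, (x, w), (x', w') => by
    intro h h' hF
    cases x <;> cases x'
    · rw [basF_inj n true i w w' (Sum.inl_injective h) (Sum.inl_injective h') hF]
    · cases h'
    · cases h
    · cases h
  | _ + 1, false, Sum.inr _, (x, w), (x', w') => by
    intro h h' hF
    cases x <;> cases x'
    · cases h
    · cases h
    · cases h'
    · cases h; cases h'; rfl
  | n + 1, true, i, (x, w), (x', w') => by
    intro h h' hF
    change basCls n false w = i at h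
    change basCls n false w' = i at h'
    have ih := basF_inj n false i w w' h h'
    have key : ∀ a b c : ℤ, 2 ^ basEx (n+1) true i * c = 2 * a - 2 * b →
        a ≡ b [ZMOD 2 ^ basEx n false i] := by
      intro a b c hc
      have e : (2:ℤ) ^ basEx (n+1) true i = 2 * 2 ^ basEx n false i := by
        rw [← pow_succ']; rfl
      rw [e] at hc
      refine (Int.modEq_iff_dvd.2 ⟨-c, ?_⟩)
      linarith
    have e : (2:ℤ) ^ basEx (n+1) true i = 2 * 2 ^ basEx n false i := by
      rw [← pow_succ']; rfl
    obtain ⟨c, hc⟩ := hF.symm.dvd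
    have i1 := basInd_pos h
    have i2 := basInd_pos h'
    cases x <;> cases x'
    · change 2 * basF n false i w - 2 * basF n false i w' = _ at hc
      exact congrArg (Prod.mk false) (ih (key _ _ c hc.symm))
    · change 2 * basF n false i w - (2 * basF n false i w' - basInd n false w' i) = _ at hc
      exfalso; rw [e, mul_assoc, i2] at hc; omega
    · change 2 * basF n false i w - basInd n false w i - 2 * basF n false i w' = _ at hc
      exfalso; rw [e, mul_assoc, i1] at hc; omega
    · change 2 * basF n false i w - basInd n false w i -
        (2 * basF n false i w' - basInd n false w' i) = _ at hc
      rw [i1, i2] at hc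
      exact congrArg (Prod.mk true) (ih (key _ _ c (by rw [← hc]; ring)))

lemma basConn : ∀ n (s : Set (BasW n)), (∀ g w, basAct n g w ∈ s ↔ w ∈ s) →
      ∀ v w, v ∈ s → w ∈ s
  | 0, _, _ => fun _ _ h => h
  | n + 1, s, hs => by
    have h10 : ∀ w, ((false, w) : Bool × BasW n) ∈ s ↔ ((true, w) : Bool × BasW n) ∈ s :=
      fun w => hs true (true, w)
    have ih := basConn n {w | ((false, w) : Bool × BasW n) ∈ s} (by
      intro g w
      cases g
      · exact (h10 _).trans (hs true (false, w))
      · exact hs false (false, w))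
    have h0 : ∀ (x : Bool) w, ((x, w) : Bool × BasW n) ∈ s ↔ ((false, w) : Bool × BasW n) ∈ s := by
      intro x w
      cases x
      · rfl
      · exact (h10 w).symm
    rintro ⟨x, v⟩ ⟨y, w⟩ h
    exact (h0 y w).2 (ih v w ((h0 x v).1 h))

/-- Words as lists. -/
def basL : (n : ℕ) → BasW n → List Bool
  | 0, _ => []
  | n + 1, (x, w) => x :: basL n w

lemma basL_inj : ∀ n, Function.Injective (basL n)
  | 0 => fun _ _ _ => rfl
  | n + 1 => by
    rintro ⟨x, w⟩ ⟨y, u⟩ h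
    simp only [basL, List.cons.injEq] at h
    rw [h.1, basL_inj n h.2]

lemma bas_basL : ∀ n g w, bas g (basL n w) = basL n (basAct n g w)
  | 0, false, _ => rfl
  | 0, true, _ => rfl
  | n + 1, false, (false, w) => congrArg (List.cons false) (bas_basL n true w)
  | _ + 1, false, (true, _) => rfl
  | n + 1, true, (false, w) => congrArg (List.cons true) (bas_basL n false w)
  | _ + 1, true, (true, _) => rfl

/-- Functions as words. -/
def basE : (n : ℕ) → (Fin n → Bool) ≃ BasW n
  | 0 => Equiv.ofUnique (Fin 0 → Bool) Unit
  | n + 1 => (Fin.consEquiv (fun _ : Fin (n + 1) => Bool)).symm.trans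
      (Equiv.prodCongr (Equiv.refl Bool) (basE n))

lemma basL_basE : ∀ n v, basL n (basE n v) = List.ofFn v
  | 0, v => by simp [basL]
  | n + 1, v => by
    rw [List.ofFn_succ]
    exact congrArg (List.cons (v 0)) (basL_basE n _)

/-- The action as permutations. -/
noncomputable def basP (n : ℕ) (g : Bool) : Equiv.Perm (Fin n → Bool) :=
  ((basE n).trans (Equiv.ofBijective (basAct n g)
    (Finite.injective_iff_bijective.1 (basAct_inj n g)))).trans (basE n).symm

lemma basE_basP (n g v) : basE n (basP n g v) = basAct n g (basE n v) := by
  simp [basP]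

lemma bas_iff (n g) (v w : Fin n → Bool) :
    bas g (List.ofFn v) = List.ofFn w ↔ basP n g v = w := by
  rw [← basL_basE, ← basL_basE, bas_basL, (basL_inj n).eq_iff, ← basE_basP, (basE n).apply_eq_iff_eq]

lemma basLapRow_eq (n) (v w : Fin n → Bool) : basLapRow n v w =
    ∑ g, (2 * (if w = v then 1 else 0) - (if basP n g v = w then 1 else 0) -
      (if basP n g w = v then 1 else 0)) := by
  unfold basLapRow
  by_cases h : w = v
  · subst h
    have : ∀ u, (if u = w then 0 else (basMult n w u : ℤ)) = (basMult n w u : ℤ) -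
        if u = w then (basMult n w u : ℤ) else 0 := by
      intro u; split_ifs <;> simp
    simp only [this, Finset.sum_sub_distrib, if_true]
    have e : ∀ g u, (basP n g u = w) ↔ (u = (basP n g).symm w) := fun g u => by
      rw [Equiv.eq_symm_apply]
    simp only [basMult, bas_iff]
    push_cast
    simp only [Finset.sum_add_distrib]
    simp only [Finset.sum_ite_eq, Finset.sum_ite_eq', Finset.mem_univ, if_true]
    have s1 : ∀ g, ∑ u, (if basP n g u = w then (1:ℤ) else 0) = 1 := by
      intro g; simp [e]
    simp only [s1, Fintype.sum_bool]
    ring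
  · simp only [h, if_false, basMult, bas_iff, Fintype.sum_bool]
    push_cast
    ring

theorem bas_crit_prod (n : ℕ) : Nonempty (BasilicaCriticalGroup n ≃+
    ((i : Σ g, BasC g n) → ZMod (2 ^ basEx n i.1 i.2))) := by
  refine basX_main (V := Fin n → Bool) (I := Σ g, BasC g n) (G := Bool) (basP n)
    (fun i => 2 ^ basEx n i.1 i.2) (fun g v => ⟨g, basCls n g (basE n v)⟩)
    (fun i v => (basF n i.1 i.2 (basE n v) : ZMod _)) ?_ ?_ ?_ ?_ ?_ (fun _ => false)
    (basLapRow n) (basLapRow_eq n)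
  · rintro ⟨h, i⟩ g v
    simp only [basE_basP]
    by_cases hg : g = h
    · subst hg
      have := (ZMod.intCast_eq_intCast_iff _ _ (2 ^ basEx n g i)).2
        (by push_cast; exact basF_same n g i (basE n v))
      rw [this]; simp [basInd]
    · obtain rfl : g = !h := by cases g <;> cases h <;> simp_all
      have := (ZMod.intCast_eq_intCast_iff _ _ (2 ^ basEx n h i)).2
        (by push_cast; exact basF_diff n h i (basE n v))
      rw [this]; simp
  · rintro ⟨h, i⟩ g v g' v' h1 h2 h3
    obtain rfl : g = h := congrArg Sigma.fst h1
    have h1' := eq_of_heq (Sigma.mk.inj h1).2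
    have hg : g' = g := congrArg Sigma.fst h2
    subst hg
    have h2' := eq_of_heq (Sigma.mk.inj h2).2
    refine ⟨rfl, (basE n).injective (basF_inj n g' _ _ _ h1' h2' ?_)⟩
    have := (ZMod.intCast_eq_intCast_iff _ _ _).1 h3
    push_cast at this
    exact this
  · rintro ⟨g, i⟩
    obtain ⟨w, hw⟩ := basCls_surj n g i
    exact ⟨g, (basE n).symm w, by simp [hw]⟩
  · intro s hs v w hv
    have := basConn n ((basE n).symm ⁻¹' s) (by
      intro g w
      have := hs g ((basE n).symm w)
      rw [← (basE n).apply_symm_apply w, ← basE_basP]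
      simpa using this) (basE n v) (basE n w)
    simpa using this (by simpa using hv)
  · intro g v
    simp only [basE_basP, basCls_act]

end BasConcrete

section BasCount

/-- Number of `a`-cycles of length `2 ^ k`. -/
def basCA (n k : ℕ) : ℕ :=
  if n < 2 * k then 0 else if n = 2 * k then 1 else if n = 2 * k + 1 then 2 else 2 ^ (n - 2 * k - 1)

/-- Number of cycles of length `2 ^ k` of a generator. -/
def basCnt : Bool → ℕ → ℕ → ℕ
  | false, n, k => basCA n k
  | true, 0, 0 => 1
  | true, _ + 1, 0 => 0
  | true, 0, _ + 1 => 0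
  | true, n + 1, k + 1 => basCA n k

lemma basW_card : ∀ n, Fintype.card (BasW n) = 2 ^ n
  | 0 => rfl
  | n + 1 => by
    rw [pow_succ', ← basW_card n, ← Fintype.card_bool, ← Fintype.card_prod]
    rfl

lemma basCnt_succ (n k : ℕ) : basCnt false (n + 1) k = basCnt true n k + if 0 = k then 2 ^ n else 0 := by
  rcases n with _ | n <;> rcases k with _ | k
  · simp [basCnt, basCA]
  · simp [basCnt, basCA]; omega
  · simp [basCnt, basCA]
  · simp only [basCnt, basCA]
    have e : n + 1 + 1 - 2 * (k + 1) - 1 = n - 2 * k - 1 := by omega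
    rw [e]
    rw [if_neg (by omega : ¬ 0 = k + 1), add_zero]
    split_ifs <;> omega

lemma basCount : ∀ n g k, Nat.card {i : BasC g n // basEx n g i = k} = basCnt g n k
  | 0, false, k => by
    change Nat.card {_i : Unit // 0 = k} = basCA 0 k
    rcases k with _ | k
    · simp [basCA]
    · simp [basCA]
  | 0, true, k => by
    change Nat.card {_i : Unit // 0 = k} = _
    rcases k with _ | k
    · simp [basCnt]
    · simp [basCnt]
  | n + 1, false, k => by
    rw [basCnt_succ, ← basCount n true k]
    have e : Nat.card {i : BasC false (n + 1) // basEx (n + 1) false i = k} =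
        Nat.card ({i : BasC true n // basEx n true i = k} ⊕ {_w : BasW n // 0 = k}) :=
      Nat.card_congr (Equiv.subtypeSum (α := BasC true n) (β := BasW n)
        (p := fun i : BasC true n ⊕ BasW n => basEx (n + 1) false i = k))
    rw [e, Nat.card_sum]
    congr 1
    by_cases hk : 0 = k
    · simp [hk, basW_card]
    · simp [hk]
  | n + 1, true, k => by
    change Nat.card {i : BasC false n // basEx n false i + 1 = k} = _
    rcases k with _ | k
    · simp [basCnt]
    · simp only [add_left_inj]
      exact basCount n false k

lemma basX_card {I : Type} [Fintype I] (f : I → ℕ) (k : ℕ) :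
    Nat.card {i // f i = k} = ∑ i, if f i = k then 1 else 0 := by
  classical
  rw [Nat.card_eq_fintype_card, Fintype.card_subtype, Finset.card_filter]

lemma basX_drop {I : Type} [Fintype I] (f : I → ℕ) :
    Nonempty (((i : I) → ZMod (2 ^ f i)) ≃+ ((i : {i // f i ≠ 0}) → ZMod (2 ^ f i.1))) := by
  classical
  let φ : ((i : I) → ZMod (2 ^ f i)) →+ ((i : {i // f i ≠ 0}) → ZMod (2 ^ f i.1)) :=
    { toFun := fun t i => t i.1
      map_zero' := rfl
      map_add' := fun _ _ => rfl }
  refine ⟨AddEquiv.ofBijective φ ⟨?_, ?_⟩⟩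
  · intro s t h
    ext i
    by_cases hi : f i = 0
    · have : Subsingleton (ZMod (2 ^ f i)) := by
        rw [hi, pow_zero]; infer_instance
      exact Subsingleton.elim _ _
    · exact congrFun h ⟨i, hi⟩
  · intro t
    refine ⟨fun i => if h : f i ≠ 0 then t ⟨i, h⟩ else 0, ?_⟩
    ext ⟨i, hi⟩
    exact dif_pos hi

lemma basX_match {I J : Type} [Fintype I] [Fintype J] (f : I → ℕ) (g : J → ℕ)
    (h : ∀ k, k ≠ 0 → Nat.card {i // f i = k} = Nat.card {j // g j = k}) :
    Nonempty (((i : I) → ZMod (2 ^ f i)) ≃+ ((j : J) → ZMod (2 ^ g j))) := by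
  classical
  obtain ⟨a⟩ := basX_drop f
  obtain ⟨b⟩ := basX_drop g
  have he : ∀ k, Nonempty ({i : {i // f i ≠ 0} // f i.1 = k} ≃ {j : {j // g j ≠ 0} // g j.1 = k}) := by
    intro k
    by_cases hk : k = 0
    · subst hk
      have : IsEmpty {i : {i // f i ≠ 0} // f i.1 = 0} := ⟨fun i => i.1.2 i.2⟩
      have : IsEmpty {j : {j // g j ≠ 0} // g j.1 = 0} := ⟨fun i => i.1.2 i.2⟩
      exact ⟨Equiv.equivOfIsEmpty _ _⟩
    · obtain ⟨e⟩ := (Finite.card_eq).1 (h k hk)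
      exact ⟨((Equiv.subtypeSubtypeEquivSubtype (p := fun i => f i ≠ 0) (q := fun i => f i = k)
        (fun h => by rw [h]; exact hk)).trans e).trans
        (Equiv.subtypeSubtypeEquivSubtype (p := fun i => g i ≠ 0) (q := fun i => g i = k)
        (fun h => by rw [h]; exact hk)).symm⟩
  let e := fun k => Classical.choice (he k)
  let E : {i // f i ≠ 0} ≃ {j // g j ≠ 0} :=
    Equiv.ofFiberEquiv (f := fun i : {i // f i ≠ 0} => f i.1)
      (g := fun j : {j // g j ≠ 0} => g j.1) e
  have hE : ∀ i, g (E i).1 = f i.1 := fun i =>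
    Equiv.ofFiberEquiv_map (f := fun i : {i // f i ≠ 0} => f i.1)
      (g := fun j : {j // g j ≠ 0} => g j.1) e i
  let c : ((i : {i // f i ≠ 0}) → ZMod (2 ^ f i.1)) ≃+
      ((i : {i // f i ≠ 0}) → ZMod (2 ^ g (E i).1)) :=
    AddEquiv.piCongrRight fun i => (ZMod.ringEquivCongr (by rw [hE i])).toAddEquiv
  let d := (RingEquiv.piCongrLeft (fun j : {j // g j ≠ 0} => ZMod (2 ^ g j.1)) E).toAddEquiv
  exact ⟨((a.trans c).trans d).trans b.symm⟩

lemma bas_card_total (n k : ℕ) :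
    Nat.card {i : Σ g, BasC g n // basEx n i.1 i.2 = k} = basCnt false n k + basCnt true n k := by
  rw [basX_card, Fintype.sum_sigma, Fintype.sum_bool, ← basCount, ← basCount, basX_card, basX_card,
    add_comm]

lemma basX_sigma (N : ℕ) (c : ℕ → ℕ) (k : ℕ) :
    ∑ s : (Σ x : Fin N, Fin (c x.1)), (if s.1.1 + 1 = k + 1 then 1 else 0) =
      if k < N then c k else 0 := by
  rw [Fintype.sum_sigma]
  simp only [Finset.sum_const, Finset.card_univ, Fintype.card_fin, smul_eq_mul, add_left_inj]
  split_ifs with hk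
  · rw [Finset.sum_eq_single ⟨k, hk⟩]
    · simp
    · intro x _ hx
      rw [if_neg, mul_zero]
      intro h; exact hx (Fin.ext h)
    · simp
  · refine Finset.sum_eq_zero fun x _ => ?_
    rw [if_neg, mul_zero]
    have := x.2
    omega

theorem bas_even (n : ℕ) (hn : 2 ≤ n) (he : Even n) : Nonempty (BasilicaCriticalGroup n ≃+
      (((k : Fin (n / 2 - 1)) →
          Fin (3 * 2 ^ (n - 2 * (k.1 + 1) - 1)) → ZMod (2 ^ (k.1 + 1))) ×
        (Fin 3 → ZMod (2 ^ (n / 2))))) := by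
  obtain ⟨a⟩ := bas_crit_prod n
  let J := (Σ x : Fin (n / 2 - 1), Fin (3 * 2 ^ (n - 2 * (x.1 + 1) - 1))) ⊕ Fin 3
  let ex : J → ℕ := Sum.elim (fun s => s.1.1 + 1) (fun _ => n / 2)
  obtain ⟨b⟩ := basX_match (fun i : Σ g, BasC g n => basEx n i.1 i.2) ex (by
    intro k hk
    obtain ⟨k, rfl⟩ := Nat.exists_eq_add_one_of_ne_zero hk
    rw [bas_card_total, basX_card, Fintype.sum_sum_type]
    change _ = (∑ s : (Σ x : Fin (n / 2 - 1), Fin (3 * 2 ^ (n - 2 * (x.1 + 1) - 1))),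
      (if s.1.1 + 1 = k + 1 then 1 else 0)) + ∑ _m : Fin 3, (if n / 2 = k + 1 then 1 else 0)
    rw [basX_sigma (n / 2 - 1) (fun x => 3 * 2 ^ (n - 2 * (x + 1) - 1)) k]
    obtain ⟨m, rfl⟩ := he
    obtain ⟨m, rfl⟩ : ∃ p, m = p + 1 := ⟨m - 1, by omega⟩
    have e1 : (m + 1 + (m + 1)) / 2 = m + 1 := by omega
    have e2 : m + 1 + (m + 1) = (2 * m + 1) + 1 := by ring
    rw [e1, e2]
    simp only [basCnt, basCA, Finset.sum_const, Finset.card_univ, Fintype.card_fin, smul_eq_mul]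
    rcases lt_trichotomy k m with h | h | h
    · obtain ⟨d, rfl⟩ : ∃ d, m = k + d + 1 := ⟨m - k - 1, by omega⟩
      have f1 : 2 * (k + d + 1) + 1 + 1 - 2 * (k + 1) - 1 = 2 * d + 1 := by omega
      have f2 : 2 * (k + d + 1) + 1 - 2 * k - 1 = 2 * d + 2 := by omega
      rw [f1, f2, if_neg (by omega), if_neg (by omega), if_neg (by omega), if_neg (by omega),
        if_neg (by omega), if_neg (by omega), if_pos (by omega), if_neg (by omega)]
      ring
    · subst h
      rw [if_neg (by omega), if_pos (by omega), if_neg (by omega), if_neg (by omega),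
        if_pos (by omega), if_neg (by omega), if_pos (by omega)]
    · rw [if_pos (by omega), if_pos (by omega), if_neg (by omega), if_neg (by omega)])
  refine ⟨(a.trans b).trans ?_⟩
  exact
    { toFun := fun t => (fun k m => t (Sum.inl ⟨k, m⟩), fun m => t (Sum.inr m))
      invFun := fun p j => match j with
        | Sum.inl s => p.1 s.1 s.2
        | Sum.inr m => p.2 m
      left_inv := by
        intro t; funext j; rcases j with s | m <;> rfl
      right_inv := fun _ => rfl
      map_add' := fun _ _ => rfl }

theorem bas_odd (n : ℕ) (hn : 2 ≤ n) (ho : Odd n) : Nonempty (BasilicaCriticalGroup n ≃+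
      (((k : Fin (n / 2 - 1)) →
          Fin (3 * 2 ^ (n - 2 * (k.1 + 1) - 1)) → ZMod (2 ^ (k.1 + 1))) ×
        (Fin 4 → ZMod (2 ^ (n / 2))) × ZMod (2 ^ (n / 2 + 1)))) := by
  obtain ⟨a⟩ := bas_crit_prod n
  let J := (Σ x : Fin (n / 2 - 1), Fin (3 * 2 ^ (n - 2 * (x.1 + 1) - 1))) ⊕ (Fin 4 ⊕ Unit)
  let ex : J → ℕ := Sum.elim (fun s => s.1.1 + 1)
    (Sum.elim (fun _ => n / 2) (fun _ => n / 2 + 1))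
  obtain ⟨b⟩ := basX_match (fun i : Σ g, BasC g n => basEx n i.1 i.2) ex (by
    intro k hk
    obtain ⟨k, rfl⟩ := Nat.exists_eq_add_one_of_ne_zero hk
    rw [bas_card_total, basX_card, Fintype.sum_sum_type, Fintype.sum_sum_type]
    change _ = (∑ s : (Σ x : Fin (n / 2 - 1), Fin (3 * 2 ^ (n - 2 * (x.1 + 1) - 1))),
      (if s.1.1 + 1 = k + 1 then 1 else 0)) + ((∑ _m : Fin 4, (if n / 2 = k + 1 then 1 else 0)) +
      ∑ _m : Unit, (if n / 2 + 1 = k + 1 then 1 else 0))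
    rw [basX_sigma (n / 2 - 1) (fun x => 3 * 2 ^ (n - 2 * (x + 1) - 1)) k]
    obtain ⟨m, rfl⟩ := ho
    obtain ⟨m, rfl⟩ : ∃ p, m = p + 1 := ⟨m - 1, by omega⟩
    have e1 : (2 * (m + 1) + 1) / 2 = m + 1 := by omega
    have e2 : 2 * (m + 1) + 1 = (2 * m + 2) + 1 := by ring
    rw [e1, e2]
    simp only [basCnt, basCA, Finset.sum_const, Finset.card_univ, Fintype.card_fin, smul_eq_mul,
      Fintype.card_unit]
    rcases lt_trichotomy k m with h | h | h
    · obtain ⟨d, rfl⟩ : ∃ d, m = k + d + 1 := ⟨m - k - 1, by omega⟩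
      have f1 : 2 * (k + d + 1) + 2 + 1 - 2 * (k + 1) - 1 = 2 * d + 2 := by omega
      have f2 : 2 * (k + d + 1) + 2 - 2 * k - 1 = 2 * d + 3 := by omega
      rw [f1, f2, if_neg (by omega), if_neg (by omega), if_neg (by omega), if_neg (by omega),
        if_neg (by omega), if_neg (by omega), if_pos (by omega), if_neg (by omega),
        if_neg (by omega)]
      ring
    · subst h
      have f2 : 2 * k + 2 - 2 * k - 1 = 1 := by omega
      rw [f2, if_neg (by omega), if_neg (by omega), if_pos (by omega), if_neg (by omega),
        if_neg (by omega), if_neg (by omega), if_neg (by omega), if_pos (by omega),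
        if_neg (by omega)]
      norm_num
    · by_cases h2 : k = m + 1
      · subst h2
        rw [if_pos (by omega), if_neg (by omega), if_pos (by omega), if_neg (by omega),
          if_neg (by omega), if_pos (by omega)]
      · rw [if_pos (by omega), if_pos (by omega), if_neg (by omega), if_neg (by omega),
          if_neg (by omega)])
  refine ⟨(a.trans b).trans ?_⟩
  exact
    { toFun := fun t => (fun k m => t (Sum.inl ⟨k, m⟩), fun m => t (Sum.inr (Sum.inl m)),
        t (Sum.inr (Sum.inr ())))
      invFun := fun p j => match j with
        | Sum.inl s => p.1 s.1 s.2
        | Sum.inr (Sum.inl m) => p.2.1 m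
        | Sum.inr (Sum.inr _) => p.2.2
      left_inv := by
        intro t; funext j; rcases j with s | m | m <;> rfl
      right_inv := fun _ => rfl
      map_add' := fun _ _ => rfl }

end BasCount

/-- The critical group of the `n`-th Basilica Schreier graph `Γ_n` is the
direct product over all cycles `C` of `Γ_n` of the groups `ℤ/|C|ℤ`:
for even `n` it is
`∏_{k=1}^{n/2−1} (ℤ/2^kℤ)^{3·2^{n−2k−1}} × (ℤ/2^{n/2}ℤ)³`, and for odd `n` it
is `∏_{k=1}^{⌊n/2⌋−1} (ℤ/2^kℤ)^{3·2^{n−2k−1}} × (ℤ/2^{⌊n/2⌋}ℤ)⁴ ×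
ℤ/2^{⌈n/2⌉}ℤ`. -/
theorem basilica_critical_group (n : ℕ) (hn : 2 ≤ n) :
    (Even n → Nonempty (BasilicaCriticalGroup n ≃+
      (((k : Fin (n / 2 - 1)) →
          Fin (3 * 2 ^ (n - 2 * (k.1 + 1) - 1)) → ZMod (2 ^ (k.1 + 1))) ×
        (Fin 3 → ZMod (2 ^ (n / 2)))))) ∧
    (Odd n → Nonempty (BasilicaCriticalGroup n ≃+
      (((k : Fin (n / 2 - 1)) →
          Fin (3 * 2 ^ (n - 2 * (k.1 + 1) - 1)) → ZMod (2 ^ (k.1 + 1))) ×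
        (Fin 4 → ZMod (2 ^ (n / 2))) × ZMod (2 ^ (n / 2 + 1))))) := by
  exact ⟨bas_even n hn, bas_odd n hn⟩
end
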